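/- arXiv:2005.11268 — 3 statements merged into one kernel-verified Lean document; each statement's English description precedes it below -/
import Mathlib

section
/- Let a, b, c be non-negative integers with min(a,b,c) = 0, and \beta, \gamma \in \mathbb{Z}_2^\times. Consider the quadratic form over \mathbb{Z}_2 in four variables L(x_1,x_2,u,w) = 2^{a+1}(x_1^2 + x_1x_2 + x_2^2) + 2^b\beta u^2 + 2^c\gamma w^2 (i.e., the orthogonal sum of the lattice \mathbb{A}^{2^a} with Gram matrix 2^a[[2,1],[1,2]] and the diagonal lattice \langle 2^b\beta, 2^c\gamma \rangle). If L is anisotropic (L(v) = 0 implies v = 0 in \mathbb{Z}_2^4), then a, b, c are all even and \beta + \gamma \equiv 4 \pmod{8\mathbb{Z}_2}. -/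
theorem aux_par (x : ℤ_[2]) : (∃ y, x = 2 * y) ∨ (∃ y, x = 1 + 2 * y) := by
  obtain ⟨n, hn, h⟩ := PadicInt.exists_mem_range (p := 2) x
  rw [PadicInt.maximalIdeal_eq_span_p, Ideal.mem_span_singleton] at h
  obtain ⟨y, hy⟩ := h
  have hn : n < 2 := by simpa using hn
  interval_cases n
  · left; exact ⟨y, by simpa using hy⟩
  · right; exact ⟨y, by push_cast at hy; linear_combination hy⟩

theorem aux_not_unit (y : ℤ_[2]) : ¬ IsUnit (2 * y) := by
  intro h
  have h2 := isUnit_of_mul_isUnit_left h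
  rw [PadicInt.isUnit_iff] at h2
  have := PadicInt.norm_p (p := 2)
  push_cast at this
  rw [this] at h2
  norm_num at h2

theorem aux_unit (y : ℤ_[2]) : IsUnit (1 + 2 * y) := by
  by_contra h
  have h1 : ∃ z, 1 + 2 * y = 2 * z := by
    have : 1 + 2 * y ∈ IsLocalRing.maximalIdeal ℤ_[2] := h
    rw [PadicInt.maximalIdeal_eq_span_p, Ideal.mem_span_singleton] at this
    simpa [dvd_def] using this
  obtain ⟨z, hz⟩ := h1
  refine aux_not_unit (z - y) ?_
  rw [show 2 * (z - y) = 1 by linear_combination -hz]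
  exact isUnit_one

theorem aux_odd (x : ℤ_[2]) (hx : IsUnit x) : ∃ y, x = 1 + 2 * y := by
  rcases aux_par x with ⟨y, rfl⟩ | h
  · exact absurd hx (aux_not_unit y)
  · exact h

theorem aux_hensel (t : ℤ_[2]) : ∃ y : ℤ_[2], y ^ 2 + y = 2 * t := by
  have := hensels_lemma (p := 2) (R := ℤ_[2])
    (F := (Polynomial.X ^ 2 + Polynomial.X - Polynomial.C (2 * t) : Polynomial ℤ_[2]))
    (a := 0) (by
      have h : ‖2 * t‖ < 1 := PadicInt.mem_nonunits.1 (aux_not_unit t)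
      simpa using h)
  obtain ⟨z, hz, -⟩ := this
  refine ⟨z, ?_⟩
  simp at hz
  linear_combination hz

/-- Lemma 3.9: if `𝔸^{2^a} ⊥ ⟨2^b β, 2^c γ⟩` over `ℤ_[2]` has scale `ℤ_[2]`
(i.e. `min a b c = 0`) and is anisotropic, then `a, b, c` are all even and
`β + γ ≡ 4 (mod 8ℤ_[2])`. -/
theorem stmt_11 (a b c : ℕ) (hmin : min a (min b c) = 0)
    (β γ : ℤ_[2]) (hβ : IsUnit β) (hγ : IsUnit γ)
    (haniso : ∀ x₁ x₂ u w : ℤ_[2],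
      2 ^ (a + 1) * (x₁ ^ 2 + x₁ * x₂ + x₂ ^ 2)
        + 2 ^ b * β * u ^ 2 + 2 ^ c * γ * w ^ 2 = 0 →
      x₁ = 0 ∧ x₂ = 0 ∧ u = 0 ∧ w = 0) :
    Even a ∧ Even b ∧ Even c ∧ ∃ δ : ℤ_[2], β + γ = 4 + 8 * δ := by
  have key : ∀ (m : ℕ) (ε u w : ℤ_[2]), IsUnit ε →
      2 ^ b * β * u ^ 2 + 2 ^ c * γ * w ^ 2 = 2 ^ m * ε → Even (m + a) := by
    intro m ε u w hε h
    by_contra hodd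
    rw [Nat.not_even_iff_odd] at hodd
    obtain ⟨k, hk⟩ := hodd
    obtain ⟨e, rfl⟩ := aux_odd ε hε
    obtain ⟨x, hx⟩ := aux_hensel (-e - 1)
    have hp : (2 : ℤ_[2]) ^ (a + 1) * (2 ^ (k + 1)) ^ 2 = 2 ^ m * (2 ^ (a + 1)) ^ 2 := by
      rw [← pow_mul, ← pow_mul, ← pow_add, ← pow_add]
      congr 1
      omega
    have h0 := haniso (2 ^ (k + 1) * x) (2 ^ (k + 1)) (2 ^ (a + 1) * u) (2 ^ (a + 1) * w) (by
      linear_combination (2 ^ (a + 1)) ^ 2 * h + (x ^ 2 + x + 1) * hp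
        + 2 ^ m * (2 ^ (a + 1)) ^ 2 * hx)
    exact pow_ne_zero _ two_ne_zero h0.2.1
  have hb := key b β 1 0 hβ (by ring)
  have hc := key c γ 0 1 hγ (by ring)
  have ha : Even a ∧ Even b ∧ Even c := by
    simp only [Nat.even_iff] at *
    omega
  obtain ⟨ha, hb, hc⟩ := ha
  refine ⟨ha, hb, hc, ?_⟩
  obtain ⟨b', rfl⟩ := hb
  obtain ⟨c', rfl⟩ := hc
  obtain ⟨β', hβ'⟩ := aux_odd β hβ
  obtain ⟨γ', hγ'⟩ := aux_odd γ hγ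
  rcases aux_par (1 + β' + γ') with ⟨e, he⟩ | ⟨e, he⟩
  · rcases aux_par e with ⟨t, ht⟩ | ⟨t, ht⟩
    · exfalso
      obtain ⟨v, hv⟩ := hβ.exists_right_inv
      obtain ⟨y, hy⟩ := aux_hensel (-t * v)
      have hs : β + γ = 8 * t := by
        linear_combination hβ' + hγ' + 2 * he + 4 * ht
      have h0 := haniso 0 0 (2 ^ c' * (1 + 2 * y)) (2 ^ b') (by
        have : β * (1 + 2 * y) ^ 2 + γ = 0 := by
          linear_combination 4 * β * hy + hs - 8 * t * hv
        linear_combination (2 ^ b') ^ 2 * (2 ^ c') ^ 2 * this)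
      exact pow_ne_zero _ two_ne_zero h0.2.2.2
    · exact ⟨t, by linear_combination hβ' + hγ' + 2 * he + 4 * ht⟩
  · exfalso
    have := key (b' + b' + (c' + c') + 1) (1 + 2 * e) (2 ^ c') (2 ^ b') (aux_unit e) (by
      have : β + γ = 2 * (1 + 2 * e) := by linear_combination hβ' + hγ' + 2 * he
      linear_combination (2 ^ b') ^ 2 * (2 ^ c') ^ 2 * this)
    simp only [Nat.even_iff] at *
    omega
end

section
/- Let p be an odd prime and let Q be a quadratic form over \mathbb{Z}_p in n \ge 5 variables. If Q is \mathbb{Z}_p-universal (every element of \mathbb{Z}_p equals Q(x) for some x \in \mathbb{Z}_p^n), then Q is primitively \mathbb{Z}_p-universal: every nonzero \alpha \in \mathbb{Z}_p equals Q(x) for some x \in \mathbb{Z}_p^n having at least one unit coordinate. -/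
theorem aux_diag (p : ℕ) [Fact p.Prime] (h2 : IsUnit (2 : ℤ_[p])) :
    ∀ (n : ℕ) (M : Type) [AddCommGroup M] [Module ℤ_[p] M] [Module.Free ℤ_[p] M]
      [Module.Finite ℤ_[p] M] (Q : QuadraticMap ℤ_[p] M ℤ_[p]),
      Module.finrank ℤ_[p] M = n →
      ∃ b : Module.Basis (Fin n) ℤ_[p] M,
        (∀ x : Fin n → ℤ_[p], Q (∑ i, x i • b i) = ∑ i, Q (b i) * x i ^ 2) ∧
        ∀ i j, i ≤ j → Q (b i) ∣ Q (b j) := by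
  intro n
  induction n with
  | zero =>
    intro M _ _ _ _ Q h
    refine ⟨Module.finBasisOfFinrankEq ℤ_[p] M h, ?_, ?_⟩
    · intro x; simp
    · intro i; exact i.elim0
  | succ n ih =>
    intro M _ _ _ _ Q h
    obtain ⟨v, hv⟩ : ∃ v : M, ∀ w, Q v ∣ Q w := by
      let f : M → ℕ∞ := fun v => IsDiscreteValuationRing.addVal ℤ_[p] (Q v)
      refine ⟨Function.argmin f, fun w => ?_⟩
      rw [← IsDiscreteValuationRing.addVal_le_iff_dvd]
      exact Function.argmin_le f w
    by_cases h0 : Q v = 0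
    · have hz : ∀ w, Q w = 0 := fun w => by
        have := hv w
        rw [h0] at this
        exact zero_dvd_iff.mp this
      refine ⟨Module.finBasisOfFinrankEq ℤ_[p] M h, ?_, ?_⟩
      · intro x; simp [hz]
      · intro i j _; simp [hz]
    · let N : Submodule ℤ_[p] M := LinearMap.ker (Q.polarBilin v)
      have hN : ∀ x, x ∈ N ↔ QuadraticMap.polar Q v x = 0 := fun x => by
        simp [N, LinearMap.mem_ker]
      have hvv : QuadraticMap.polar Q v v = 2 * Q v := by
        rw [QuadraticMap.polar_self]; simp
      have hli : ∀ (c : ℤ_[p]), ∀ x ∈ N, c • v + x = 0 → c = 0 := by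
        intro c x hx hc
        have h1 : QuadraticMap.polar Q v (c • v + x) = 0 := by rw [hc]; simp
        rw [QuadraticMap.polar_add_right, QuadraticMap.polar_smul_right, hvv, (hN x).1 hx] at h1
        have h3 : (2 : ℤ_[p]) ≠ 0 := h2.ne_zero
        simpa [h3, h0] using h1
      have hsp : ∀ z : M, ∃ c : ℤ_[p], z + c • v ∈ N := by
        intro z
        have hd : Q v ∣ QuadraticMap.polar Q v z := by
          unfold QuadraticMap.polar
          exact dvd_sub (dvd_sub (hv _) (hv _)) (hv _)
        obtain ⟨e, he⟩ := hd
        obtain ⟨t, ht⟩ := h2.exists_right_inv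
        refine ⟨-(t * e), ?_⟩
        rw [hN, QuadraticMap.polar_add_right, QuadraticMap.polar_smul_right, hvv, he]
        simp only [smul_eq_mul]
        linear_combination (-(e * Q v)) * ht
      have hk : Module.finrank ℤ_[p] N = n := by
        have b' := Module.Basis.mkFinCons v (Module.finBasis ℤ_[p] N) hli hsp
        have := Module.finrank_eq_card_basis b'
        rw [h] at this
        simp at this
        omega
      obtain ⟨b, hb1, hb2⟩ := ih N (Q.comp N.subtype) hk
      refine ⟨Module.Basis.mkFinCons v b hli hsp, ?_, ?_⟩
      · intro x
        rw [Module.Basis.coe_mkFinCons, Fin.sum_univ_succ, Fin.sum_univ_succ]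
        simp only [Fin.cons_zero, Fin.cons_succ, Function.comp]
        have hs : ∑ i : Fin n, x i.succ • ((b i : N) : M) =
            ((∑ i : Fin n, x i.succ • b i : N) : M) := by simp
        have hb := hb1 (fun i => x i.succ)
        simp only [QuadraticMap.comp_apply, Submodule.subtype_apply] at hb
        rw [hs, QuadraticMap.map_add Q, QuadraticMap.polar_smul_left,
          (hN _).1 (Subtype.property _), hb, QuadraticMap.map_smul]
        simp only [smul_eq_mul]
        ring
      · intro i j hij
        rw [Module.Basis.coe_mkFinCons]
        refine Fin.cases ?_ (fun i => ?_) i |> fun (h : i ≤ j → _) => h hij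
        · intro _; exact hv _
        · refine Fin.cases ?_ (fun j => ?_) j
          · intro h; simp at h
          · intro h
            have := hb2 i j (Fin.succ_le_succ_iff.mp h)
            simpa using this

theorem aux_red (p : ℕ) [Fact p.Prime] (z : ℤ_[p]) :
    PadicInt.toZMod z = 0 ↔ ¬ IsUnit z := by
  rw [← RingHom.mem_ker, PadicInt.ker_toZMod, IsLocalRing.mem_maximalIdeal, mem_nonunits_iff]

theorem aux_dvd (p : ℕ) [Fact p.Prime] (z : ℤ_[p]) :
    (p : ℤ_[p]) ∣ z ↔ ¬ IsUnit z := by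
  rw [← PadicInt.norm_lt_one_iff_dvd, PadicInt.not_isUnit_iff]

theorem aux_surj (p : ℕ) [Fact p.Prime] (z : ZMod p) :
    ∃ y : ℤ_[p], PadicInt.toZMod y = z :=
  ⟨(z.val : ℤ_[p]), by simp⟩

theorem aux_two (p : ℕ) [Fact p.Prime] (hp : p ≠ 2) : IsUnit (2 : ℤ_[p]) := by
  by_contra h
  rw [← aux_red] at h
  have h3 : (2 : ZMod p) = 0 := by rw [← map_ofNat (PadicInt.toZMod (p := p)) 2]; exact h
  have : ((2 : ℕ) : ZMod p) = 0 := by exact_mod_cast h3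
  rw [ZMod.natCast_eq_zero_iff] at this
  exact hp ((Nat.prime_dvd_prime_iff_eq Fact.out Nat.prime_two).1 this)

theorem aux_sqrt (p : ℕ) [Fact p.Prime] (hp : p ≠ 2) (t : ℤ_[p]) (a : ZMod p) (ha : a ≠ 0)
    (h : PadicInt.toZMod t = a ^ 2) : ∃ x, x ^ 2 = t := by
  obtain ⟨y, rfl⟩ := aux_surj p a
  have hy : IsUnit y := by
    by_contra hn
    exact ha ((aux_red p y).2 hn)
  have h1 : ‖y ^ 2 - t‖ < 1 := by
    rw [PadicInt.norm_lt_one_iff_dvd, aux_dvd, ← aux_red]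
    simp [h]
  have h2 : ‖2 * y‖ = 1 := PadicInt.isUnit_iff.1 ((aux_two p hp).mul hy)
  have := hensels_lemma (p := p) (R := ℤ_[p]) (F := Polynomial.X ^ 2 - Polynomial.C t) (a := y)
    (by
      have e1 : (Polynomial.aeval y) (Polynomial.X ^ 2 - Polynomial.C t) = y ^ 2 - t := by simp
      have e2 : (Polynomial.aeval y) (Polynomial.derivative (Polynomial.X ^ 2 - Polynomial.C t))
          = 2 * y := by simp [one_add_one_eq_two]
      rw [e1, e2, h2, one_pow]
      exact h1)
  obtain ⟨z, hz, -⟩ := this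
  refine ⟨z, ?_⟩
  simpa [sub_eq_zero] using hz

theorem aux_bin (p : ℕ) [Fact p.Prime] (hp : p ≠ 2) (d e u : ℤ_[p]) (hd : IsUnit d)
    (he : IsUnit e) (hu : IsUnit u) : ∃ x y, d * x ^ 2 + e * y ^ 2 = u := by
  have key : ∀ (d e : ℤ_[p]) (a b : ZMod p), IsUnit d → a ≠ 0 →
      PadicInt.toZMod d * a ^ 2 + PadicInt.toZMod e * b ^ 2 = PadicInt.toZMod u →
      ∃ x y, d * x ^ 2 + e * y ^ 2 = u := by
    intro d e a b hd ha h
    obtain ⟨y, rfl⟩ := aux_surj p b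
    obtain ⟨d', hd'⟩ := hd.exists_right_inv
    have hm : PadicInt.toZMod d * PadicInt.toZMod d' = 1 := by rw [← map_mul, hd', map_one]
    obtain ⟨x, hx⟩ := aux_sqrt p hp (d' * (u - e * y ^ 2)) a ha (by
      simp only [map_mul, map_sub, map_pow]
      rw [← h]
      linear_combination a ^ 2 * hm)
    refine ⟨x, y, ?_⟩
    rw [hx]
    linear_combination (u - e * y ^ 2) * hd'
  have hdz : PadicInt.toZMod d ≠ 0 := fun h => (aux_red p d).1 h hd
  have hez : PadicInt.toZMod e ≠ 0 := fun h => (aux_red p e).1 h he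
  have huz : PadicInt.toZMod u ≠ 0 := fun h => (aux_red p u).1 h hu
  obtain ⟨a, b, hab⟩ := FiniteField.exists_root_sum_quadratic (R := ZMod p)
    (f := Polynomial.C (PadicInt.toZMod d) * Polynomial.X ^ 2 + Polynomial.C 0 * Polynomial.X
      + Polynomial.C 0)
    (g := Polynomial.C (PadicInt.toZMod e) * Polynomial.X ^ 2 + Polynomial.C 0 * Polynomial.X
      + Polynomial.C (-PadicInt.toZMod u))
    (Polynomial.degree_quadratic hdz) (Polynomial.degree_quadratic hez)
    (by rw [ZMod.card]; exact ((Fact.out : p.Prime).eq_two_or_odd).resolve_left hp)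
  simp at hab
  have hab' : PadicInt.toZMod d * a ^ 2 + PadicInt.toZMod e * b ^ 2 = PadicInt.toZMod u := by
    linear_combination hab
  by_cases ha : a = 0
  · have hb : b ≠ 0 := by
      rintro rfl
      subst ha
      simp at hab'
      exact huz hab'.symm
    obtain ⟨x, y, h⟩ := key e d b a he hb (by rw [add_comm]; exact hab')
    exact ⟨y, x, by rw [add_comm]; exact h⟩
  · exact key d e a b hd ha hab'

theorem aux_nr (p : ℕ) [Fact p.Prime] (hp : p ≠ 2) (d : ℤ_[p]) :
    ∃ u : ℤ_[p], IsUnit u ∧ ∀ x, IsUnit (u - d * x ^ 2) := by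
  by_cases hd : IsUnit d
  · obtain ⟨g, hg⟩ := FiniteField.exists_nonsquare (F := ZMod p) (by rwa [ZMod.ringChar_zmod_n])
    obtain ⟨y, rfl⟩ := aux_surj p g
    have hy : IsUnit y := by
      by_contra h
      rw [← aux_red] at h
      rw [h] at hg
      exact hg (IsSquare.zero)
    refine ⟨d * y, hd.mul hy, fun x => ?_⟩
    rw [← mul_sub]
    refine hd.mul ?_
    by_contra h
    rw [← aux_red, map_sub, sub_eq_zero, map_pow] at h
    exact hg ⟨_, h.trans (sq _)⟩
  · refine ⟨1, isUnit_one, fun x => ?_⟩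
    by_contra h
    rw [← aux_red] at h hd
    simp [hd] at h

theorem aux_univ4 (p : ℕ) [Fact p.Prime] (hp : p ≠ 2) (d0 d1 e2 e3 : ℤ_[p]) (h0 : IsUnit d0)
    (h1 : IsUnit d1) (h2 : IsUnit e2) (h3 : IsUnit e3) (β : ℤ_[p]) :
    ∃ x0 x1 x2 x3, d0 * x0 ^ 2 + d1 * x1 ^ 2 + p * e2 * x2 ^ 2 + p * e3 * x3 ^ 2 = β := by
  by_cases hβ : β = 0
  · exact ⟨0, 0, 0, 0, by simp [hβ]⟩
  have hs := PadicInt.unitCoeff_spec hβ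
  generalize β.valuation = m at hs
  have hu : IsUnit ((PadicInt.unitCoeff hβ : ℤ_[p]ˣ) : ℤ_[p]) := Units.isUnit _
  generalize ((PadicInt.unitCoeff hβ : ℤ_[p]ˣ) : ℤ_[p]) = u at hs hu
  obtain ⟨k, hk | hk⟩ := Nat.even_or_odd' m
  · obtain ⟨x, y, h⟩ := aux_bin p hp d0 d1 u h0 h1 hu
    refine ⟨p ^ k * x, p ^ k * y, 0, 0, ?_⟩
    rw [hs, hk, ← h]; ring
  · obtain ⟨x, y, h⟩ := aux_bin p hp e2 e3 u h2 h3 hu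
    refine ⟨0, 0, p ^ k * x, p ^ k * y, ?_⟩
    rw [hs, hk, ← h]; ring

theorem aux_core (p : ℕ) [Fact p.Prime] (hp : p ≠ 2) (d0 d1 d2 d3 d4 : ℤ_[p])
    (h01 : d0 ∣ d1) (h12 : d1 ∣ d2) (h23 : d2 ∣ d3) (h34 : d3 ∣ d4)
    (hun : ∀ α, ∃ x0 x1 x2 x3 s,
      d0 * x0 ^ 2 + d1 * x1 ^ 2 + d2 * x2 ^ 2 + d3 * x3 ^ 2 + d4 * s = α)
    (α : ℤ_[p]) (hα : (p : ℤ_[p]) ∣ α) :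
    ((p : ℤ_[p]) ^ 2 ∣ α) → ∃ x0 x1 x2 x3 x4,
      (IsUnit x0 ∨ IsUnit x1 ∨ IsUnit x2 ∨ IsUnit x3 ∨ IsUnit x4) ∧
      d0 * x0 ^ 2 + d1 * x1 ^ 2 + d2 * x2 ^ 2 + d3 * x3 ^ 2 + d4 * x4 ^ 2 = α := by
  intro _
  have hu1 : IsUnit d1 := by
    by_contra hn
    rw [← aux_dvd] at hn
    obtain ⟨u, -, hu⟩ := aux_nr p hp d0
    obtain ⟨x0, x1, x2, x3, s, h⟩ := hun u
    refine (aux_dvd p _).1 ?_ (hu x0)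
    have e2 := hn.trans h12
    have e3 := e2.trans h23
    have e4 := e3.trans h34
    have : u - d0 * x0 ^ 2 = d1 * x1 ^ 2 + d2 * x2 ^ 2 + d3 * x3 ^ 2 + d4 * s := by
      rw [← h]; ring
    rw [this]
    exact dvd_add (dvd_add (dvd_add (hn.mul_right _) (e2.mul_right _)) (e3.mul_right _))
      (e4.mul_right _)
  have hu0 : IsUnit d0 := isUnit_of_dvd_unit h01 hu1
  by_cases hu2 : IsUnit d2
  · have : IsUnit (α - d2) := by
      by_contra h
      rw [← aux_dvd] at h
      have h' := dvd_sub hα h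
      rw [sub_sub_cancel] at h'
      exact (aux_dvd p _).1 h' hu2
    obtain ⟨x, y, h⟩ := aux_bin p hp d0 d1 _ hu0 hu1 this
    exact ⟨x, y, 1, 0, 0, by simp, by linear_combination h⟩
  have hαz : PadicInt.toZMod α = 0 := (aux_red p α).2 ((aux_dvd p α).1 hα)
  have hd0z : PadicInt.toZMod d0 ≠ 0 := fun h => (aux_red p d0).1 h hu0
  have hd1z : PadicInt.toZMod d1 ≠ 0 := fun h => (aux_red p d1).1 h hu1
  by_cases hiso : ∃ t : ZMod p, PadicInt.toZMod d0 * t ^ 2 + PadicInt.toZMod d1 = 0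
  · obtain ⟨t, ht⟩ := hiso
    have ht0 : t ≠ 0 := by
      rintro rfl
      simp at ht
      exact hd1z ht
    obtain ⟨d', hd'⟩ := hu0.exists_right_inv
    have hm : PadicInt.toZMod d0 * PadicInt.toZMod d' = 1 := by rw [← map_mul, hd', map_one]
    obtain ⟨x, hx⟩ := aux_sqrt p hp (d' * (α - d1)) t ht0 (by
      simp only [map_mul, map_sub, hαz]
      linear_combination t ^ 2 * hm - PadicInt.toZMod d' * ht)
    refine ⟨x, 1, 0, 0, 0, by simp, ?_⟩
    rw [hx]
    linear_combination (α - d1) * hd'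
  have hp0 : (p : ℤ_[p]) ≠ 0 := by exact_mod_cast (Fact.out : p.Prime).ne_zero
  rw [← aux_dvd] at hu2
  obtain ⟨e2, rfl⟩ := hu2
  obtain ⟨f3, rfl⟩ := h23
  obtain ⟨f4, rfl⟩ := h34
  have hu3 : IsUnit (e2 * f3) := by
    by_contra hn
    rw [← aux_dvd] at hn
    obtain ⟨u, -, hu⟩ := aux_nr p hp e2
    obtain ⟨x0, x1, x2, x3, s, h⟩ := hun (p * u)
    have hz := congrArg PadicInt.toZMod h
    simp only [map_add, map_mul, map_pow, map_natCast, CharP.cast_eq_zero, zero_mul,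
      add_zero] at hz
    have hx1 : PadicInt.toZMod x1 = 0 := by
      by_contra hx1
      refine hiso ⟨PadicInt.toZMod x0 / PadicInt.toZMod x1, ?_⟩
      field_simp
      linear_combination hz
    have hx0 : PadicInt.toZMod x0 = 0 := by
      simpa [hx1, hd0z] using hz
    rw [aux_red, ← aux_dvd] at hx0 hx1
    obtain ⟨y0, rfl⟩ := hx0
    obtain ⟨y1, rfl⟩ := hx1
    refine (aux_dvd p _).1 ?_ (hu x2)
    have : u - e2 * x2 ^ 2 = p * (d0 * y0 ^ 2 + d1 * y1 ^ 2) + e2 * f3 * (x3 ^ 2 + f4 * s) := by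
      apply mul_left_cancel₀ hp0
      linear_combination -h
    rw [this]
    exact dvd_add (dvd_mul_right _ _) (hn.mul_right _)
  have hu2 : IsUnit e2 := isUnit_of_mul_isUnit_left hu3
  obtain ⟨x0, x1, x2, x3, h⟩ := aux_univ4 p hp d0 d1 e2 (e2 * f3) hu0 hu1 hu2 hu3
    (α - p * e2 * f3 * f4)
  exact ⟨x0, x1, x2, x3, 1, by simp, by linear_combination h⟩

/-- Proposition 4.2: for an odd prime `p`, a `ℤ_[p]`-universal quadratic form in
`n ≥ 5` variables is primitively `ℤ_[p]`-universal. -/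
theorem stmt_13 (p : ℕ) [Fact p.Prime] (hp : p ≠ 2)
    {n : ℕ} (hn : 5 ≤ n) (a : Fin n → Fin n → ℤ_[p])
    (Q : (Fin n → ℤ_[p]) → ℤ_[p])
    (hQ : ∀ x, Q x = ∑ i : Fin n, ∑ j ∈ Finset.Ici i, a i j * x i * x j)
    (huniv : ∀ α : ℤ_[p], ∃ x : Fin n → ℤ_[p], Q x = α) :
    ∀ α : ℤ_[p], α ≠ 0 →
      ∃ x : Fin n → ℤ_[p], (∃ i, IsUnit (x i)) ∧ Q x = α := by
  intro α _
  let q : QuadraticMap ℤ_[p] (Fin n → ℤ_[p]) ℤ_[p] :=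
    ∑ i : Fin n, ∑ j ∈ Finset.Ici i, a i j • QuadraticMap.linMulLin
      (LinearMap.proj (R := ℤ_[p]) (φ := fun _ : Fin n => ℤ_[p]) i)
      (LinearMap.proj (R := ℤ_[p]) (φ := fun _ : Fin n => ℤ_[p]) j)
  have hq : ∀ x, Q x = q x := by
    intro x
    rw [hQ]
    simp [q, mul_assoc]
  -- the nonprimitive vectors are the multiples of `p`
  have hprim : ∀ x : Fin n → ℤ_[p], (¬ ∃ i, IsUnit (x i)) → ∃ y, x = (p : ℤ_[p]) • y := by
    intro x hx
    push Not at hx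
    have : ∀ i, ∃ y, x i = p * y := fun i => (aux_dvd p _).2 (hx i)
    choose y hy using this
    exact ⟨y, funext hy⟩
  by_cases hα : (p : ℤ_[p]) ^ 2 ∣ α
  swap
  · obtain ⟨x, hx⟩ := huniv α
    refine ⟨x, ?_, hx⟩
    by_contra h
    obtain ⟨y, rfl⟩ := hprim x h
    apply hα
    rw [← hx, hq, QuadraticMap.map_smul, smul_eq_mul, sq]
    exact dvd_mul_right _ _
  obtain ⟨m, rfl⟩ : ∃ m, n = m + 1 + 1 + 1 + 1 + 1 := ⟨n - 5, by omega⟩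
  obtain ⟨b, hb1, hb2⟩ := aux_diag p (aux_two p hp) _ _ q (Module.finrank_fin_fun ℤ_[p])
  let d := fun i => q (b i)
  have hd : ∀ i j, i ≤ j → d i ∣ d j := hb2
  have hb1' : ∀ x : Fin (m + 1 + 1 + 1 + 1 + 1) → ℤ_[p], q (∑ i, x i • b i) = ∑ i, d i * x i ^ 2 := hb1
  let i1 : Fin (m + 1 + 1 + 1 + 1 + 1) := Fin.succ 0
  let i2 : Fin (m + 1 + 1 + 1 + 1 + 1) := Fin.succ (Fin.succ 0)
  let i3 : Fin (m + 1 + 1 + 1 + 1 + 1) := Fin.succ (Fin.succ (Fin.succ 0))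
  let i4 : Fin (m + 1 + 1 + 1 + 1 + 1) := Fin.succ (Fin.succ (Fin.succ (Fin.succ 0)))
  have hcore := aux_core p hp (d 0) (d i1) (d i2) (d i3) (d i4)
    (hd _ _ (Fin.zero_le _)) (hd _ _ (Fin.le_def.2 (show 1 ≤ 2 by omega)))
    (hd _ _ (Fin.le_def.2 (show 2 ≤ 3 by omega))) (hd _ _ (Fin.le_def.2 (show 3 ≤ 4 by omega)))
    (by
      intro β
      obtain ⟨z, hz⟩ := huniv β
      have h1 := hb1' (b.repr z)
      rw [b.sum_repr, ← hq, hz] at h1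
      simp only [Fin.sum_univ_succ (n := m + 1 + 1 + 1 + 1), Fin.sum_univ_succ (n := m + 1 + 1 + 1),
        Fin.sum_univ_succ (n := m + 1 + 1), Fin.sum_univ_succ (n := m + 1)] at h1
      have ht : d i4 ∣ ∑ i : Fin (m + 1), d i.succ.succ.succ.succ *
          b.repr z i.succ.succ.succ.succ ^ 2 :=
        Finset.dvd_sum fun i _ => (hd _ _ (Fin.le_def.2 (show 4 ≤ i.val + 4 by omega))).mul_right _
      obtain ⟨s, hs⟩ := ht
      rw [hs] at h1
      exact ⟨b.repr z 0, b.repr z i1, b.repr z i2, b.repr z i3, s, by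
        rw [h1]; simp only [i1, i2, i3]; ring⟩)
    α ((dvd_pow_self _ two_ne_zero).trans hα) hα
  obtain ⟨x0, x1, x2, x3, x4, hunit, hx⟩ := hcore
  let X : Fin (m + 1 + 1 + 1 + 1 + 1) → ℤ_[p] :=
    Fin.cons x0 (Fin.cons x1 (Fin.cons x2 (Fin.cons x3 (Fin.cons x4 (fun _ => 0)))))
  have hX : ∃ i, IsUnit (X i) := by
    rcases hunit with h | h | h | h | h
    · exact ⟨0, h⟩
    · exact ⟨i1, h⟩
    · exact ⟨i2, h⟩
    · exact ⟨i3, h⟩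
    · exact ⟨i4, h⟩
  refine ⟨∑ i, X i • b i, ?_, ?_⟩
  · by_contra hno
    obtain ⟨y, hy⟩ := hprim _ hno
    obtain ⟨i, hi⟩ := hX
    have h1 := congrArg (fun v => b.repr v i) hy
    simp only [b.repr_sum_self, map_smul, Finsupp.smul_apply, smul_eq_mul] at h1
    refine (aux_dvd p _).1 ?_ hi
    rw [h1]
    exact dvd_mul_right _ _
  · rw [hq, hb1', ← hx]
    simp only [Fin.sum_univ_succ (n := m + 1 + 1 + 1 + 1), Fin.sum_univ_succ (n := m + 1 + 1 + 1),
        Fin.sum_univ_succ (n := m + 1 + 1), Fin.sum_univ_succ (n := m + 1),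
        Fin.sum_univ_succ (n := m)]
    simp only [X, Fin.cons_zero, Fin.cons_succ, i1, i2, i3, i4]
    simp
    ring
end

section
/- Let Q be a quadratic form over \mathbb{Z}_2 in n \ge 5 variables. If Q is \mathbb{Z}_2-universal (every element of \mathbb{Z}_2 equals Q(x) for some x \in \mathbb{Z}_2^n), then Q is primitively \mathbb{Z}_2-universal: every nonzero \alpha \in \mathbb{Z}_2 equals Q(x) for some x \in \mathbb{Z}_2^n having at least one unit coordinate. -/
namespace PU

/-- All 64 bits set. -/
def full : ℕ := 18446744073709551615

/-- Reduce a bit mask modulo 64. -/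
def fold (A : ℕ) : ℕ := Nat.lor (Nat.mod A 18446744073709551616) (Nat.shiftRight A 64)

/-- Adjoin to a mask its translate by `a`. -/
def adj (A a : ℕ) : ℕ := Nat.lor A (fold (Nat.shiftLeft A a))

/-- `grow k A r`: mask of `A + 2^r ℤ_2`, provided `r + k ≥ 6`. -/
def grow : ℕ → ℕ → ℕ → ℕ
  | 0, A, _ => A
  | k + 1, A, r => grow k (adj A (Nat.pow 2 r)) (Nat.succ r)

/-- mask of `A + c + 2^r ℤ_2`. -/
def coset (A c r : ℕ) : ℕ := grow (Nat.sub 6 r) (fold (Nat.shiftLeft A c)) r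

/-- mask of `A + V_b`. -/
def addV (A c r : ℕ) : ℕ :=
  Nat.lor A (Nat.lor (coset A c r)
    (Nat.lor (coset A (Nat.mod (Nat.mul 4 c) 64) (Nat.add r 2))
      (coset A (Nat.mod (Nat.mul 16 c) 64) (Nat.add r 4))))

/-- mask of new primitive values. -/
def addP (V P c r : ℕ) : ℕ := Nat.lor (coset V c r) (addV P c r)

def force {α : Type} (n : ℕ) (f : ℕ → α) : α :=
  Nat.rec (f 0) (fun k _ => f (Nat.succ k)) n

def m4 : ℕ := 1229782938247303441

def check : ℕ → ℕ → ℕ → ℕ → ℕ → Bool → Bool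
  | 0, _, _, _, _, _ => false
  | k + 1, V, P, d, m, ph =>
    (Nat.ble (Nat.succ (grow (Nat.sub 6 m) V m)) full) ||
    ((Nat.beq P full) ||
    ((Nat.ble d 4 && Nat.beq (Nat.lor P m4) full) ||
    (Nat.ble m 3 &&
    (match ph with
    | false =>
      (force (addV V 0 m) fun V' => force (addP V P 0 m) fun P' =>
        check k V' P' (Nat.add d 2) m false) &&
      ((force (addV V (Nat.pow 2 m) (Nat.succ m)) fun V' =>
        force (addP V P (Nat.pow 2 m) (Nat.succ m)) fun P' =>
        check k V' P' (Nat.add d 2) m false) &&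
      check k V P d m true)
    | true =>
      ((force (addV V (Nat.pow 2 m) (Nat.add m 3)) fun V' =>
        force (addP V P (Nat.pow 2 m) (Nat.add m 3)) fun P' =>
        check k V' P' (Nat.add d 1) m true) &&
      ((force (addV V (Nat.mul (Nat.pow 2 m) 3) (Nat.add m 3)) fun V' =>
        force (addP V P (Nat.mul (Nat.pow 2 m) 3) (Nat.add m 3)) fun P' =>
        check k V' P' (Nat.add d 1) m true) &&
      ((force (addV V (Nat.mul (Nat.pow 2 m) 5) (Nat.add m 3)) fun V' =>
        force (addP V P (Nat.mul (Nat.pow 2 m) 5) (Nat.add m 3)) fun P' =>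
        check k V' P' (Nat.add d 1) m true) &&
      ((force (addV V (Nat.mul (Nat.pow 2 m) 7) (Nat.add m 3)) fun V' =>
        force (addP V P (Nat.mul (Nat.pow 2 m) 7) (Nat.add m 3)) fun P' =>
        check k V' P' (Nat.add d 1) m true) &&
      check k V P d (Nat.succ m) false))))))))


/-- The set of 2-adic integers described by a bit mask modulo 64. -/
def sem (A : ℕ) : Set ℤ_[2] := {α | ∃ i : ℕ, A.testBit i = true ∧ (64 : ℤ_[2]) ∣ α - (i : ℤ_[2])}

theorem sem_lor (A B : ℕ) (α : ℤ_[2]) : α ∈ sem (Nat.lor A B) ↔ α ∈ sem A ∨ α ∈ sem B := by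
  change α ∈ sem (A ||| B) ↔ _
  simp only [sem, Set.mem_ofPred_eq, Nat.testBit_or, Bool.or_eq_true]
  grind

theorem sem_fold (A : ℕ) (α : ℤ_[2]) : α ∈ sem (fold A) ↔ α ∈ sem A := by
  unfold fold
  rw [sem_lor]
  have h1 : Nat.mod A 18446744073709551616 = A % 2 ^ 64 := by norm_num; rfl
  have h2 : Nat.shiftRight A 64 = A >>> 64 := rfl
  rw [h1, h2]
  simp only [sem, Set.mem_ofPred_eq, Nat.testBit_mod_two_pow, Nat.testBit_shiftRight,
    Bool.and_eq_true, decide_eq_true_eq]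
  constructor
  · rintro (⟨i, ⟨_, hi⟩, h⟩ | ⟨i, hi, h⟩)
    · exact ⟨i, hi, h⟩
    · refine ⟨64 + i, hi, ?_⟩
      obtain ⟨t, ht⟩ := h
      exact ⟨t - 1, by push_cast; linear_combination ht⟩
  · rintro ⟨i, hi, h⟩
    by_cases h64 : i < 64
    · exact Or.inl ⟨i, ⟨h64, hi⟩, h⟩
    · right
      obtain ⟨j, rfl⟩ := Nat.exists_eq_add_of_le (not_lt.mp h64)
      refine ⟨j, hi, ?_⟩
      obtain ⟨t, ht⟩ := h
      exact ⟨t + 1, by push_cast at ht; linear_combination ht⟩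

theorem sem_shift (A a : ℕ) (α : ℤ_[2]) :
    α ∈ sem (Nat.shiftLeft A a) ↔ α - (a : ℤ_[2]) ∈ sem A := by
  change α ∈ sem (A <<< a) ↔ _
  simp only [sem, Set.mem_ofPred_eq, Nat.testBit_shiftLeft, Bool.and_eq_true, decide_eq_true_eq]
  constructor
  · rintro ⟨i, ⟨h1, h2⟩, h⟩
    refine ⟨i - a, h2, ?_⟩
    rw [Nat.cast_sub h1]
    simpa using h
  · rintro ⟨i, h2, h⟩
    refine ⟨i + a, ⟨by omega, by simpa using h2⟩, ?_⟩
    push_cast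
    convert h using 1; ring

theorem sem_congr {A : ℕ} {α β : ℤ_[2]} (h : (64 : ℤ_[2]) ∣ α - β) (hα : α ∈ sem A) :
    β ∈ sem A := by
  obtain ⟨i, hi, h'⟩ := hα
  refine ⟨i, hi, ?_⟩
  have := dvd_sub h' h
  convert this using 1; ring

theorem sem_adj (A a : ℕ) (α : ℤ_[2]) :
    α ∈ sem (adj A a) ↔ α ∈ sem A ∨ α - (a : ℤ_[2]) ∈ sem A := by
  unfold adj
  rw [sem_lor, sem_fold, sem_shift]

theorem parity (t : ℤ_[2]) : (∃ s, t = 2 * s) ∨ ∃ s, t = 2 * s + 1 := by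
  have h := PadicInt.exists_mem_range t
  obtain ⟨n, hn, h⟩ := h
  rw [PadicInt.maximalIdeal_eq_span_p, Ideal.mem_span_singleton] at h
  obtain ⟨s, hs⟩ := h
  have hn' : n = 0 ∨ n = 1 := by omega
  rcases hn' with rfl | rfl
  · left; exact ⟨s, by push_cast at hs; linear_combination hs⟩
  · right; exact ⟨s, by push_cast at hs; linear_combination hs⟩

theorem sem_grow (k A r : ℕ) (h : 6 ≤ r + k) (α : ℤ_[2]) :
    α ∈ sem (grow k A r) ↔ ∃ t : ℤ_[2], α - 2 ^ r * t ∈ sem A := by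
  induction k generalizing A r with
  | zero =>
    change α ∈ sem A ↔ _
    constructor
    · intro h; exact ⟨0, by simpa using h⟩
    · rintro ⟨t, ht⟩
      refine sem_congr ?_ ht
      obtain ⟨j, rfl⟩ := Nat.exists_eq_add_of_le h
      exact ⟨-(2 ^ j * t), by simp only [pow_add]; ring⟩
  | succ k ih =>
    change α ∈ sem (grow k (adj A (2 ^ r)) (r + 1)) ↔ _
    rw [ih _ _ (by omega)]
    simp only [sem_adj]
    constructor
    · rintro ⟨t, ht | ht⟩
      · exact ⟨2 * t, by convert ht using 1; ring⟩
      · exact ⟨2 * t + 1, by convert ht using 1; push_cast; ring⟩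
    · rintro ⟨t, ht⟩
      rcases parity t with ⟨s, rfl⟩ | ⟨s, rfl⟩
      · exact ⟨s, Or.inl (by convert ht using 1; ring)⟩
      · exact ⟨s, Or.inr (by convert ht using 1; push_cast; ring)⟩

theorem sem_coset (A c r : ℕ) (α : ℤ_[2]) :
    α ∈ sem (coset A c r) ↔ ∃ t : ℤ_[2], α - (c + 2 ^ r * t) ∈ sem A := by
  unfold coset
  have : 6 ≤ r + Nat.sub 6 r := by change 6 ≤ r + (6 - r); omega
  rw [sem_grow _ _ _ this]
  simp only [sem_fold, sem_shift]
  refine exists_congr fun t => ?_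
  rw [show α - 2 ^ r * t - (c : ℤ_[2]) = α - (c + 2 ^ r * t) by ring]

/-- Primitive values of a block. -/
def bP (c r : ℕ) : Set ℤ_[2] := {α | ∃ t : ℤ_[2], α = c + 2 ^ r * t}
/-- All values of a block. -/
def bV (c r : ℕ) : Set ℤ_[2] := {α | α = 0 ∨ ∃ (j : ℕ) (p : ℤ_[2]), p ∈ bP c r ∧ α = 4 ^ j * p}

theorem sem_coset_mod (A c r e : ℕ) (α : ℤ_[2]) :
    α ∈ sem (coset A (Nat.mod (Nat.mul (4 ^ e) c) 64) (Nat.add r (2 * e))) ↔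
      ∃ p ∈ bP c r, α - 4 ^ e * p ∈ sem A := by
  rw [sem_coset]
  have hm : ∃ q : ℕ, (4 ^ e) * c = Nat.mod (Nat.mul (4 ^ e) c) 64 + 64 * q :=
    ⟨_, (Nat.mod_add_div _ 64).symm⟩
  obtain ⟨q, hq⟩ := hm
  generalize Nat.mod (Nat.mul (4 ^ e) c) 64 = c' at *
  have hq' : (4 : ℤ_[2]) ^ e * c = c' + 64 * q := by exact_mod_cast hq
  have hr : (2 : ℤ_[2]) ^ (Nat.add r (2 * e)) = 4 ^ e * 2 ^ r := by
    change (2 : ℤ_[2]) ^ (r + 2 * e) = _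
    rw [pow_add, pow_mul]; norm_num; ring
  rw [hr]
  constructor
  · rintro ⟨t, ht⟩
    exact ⟨_, ⟨t, rfl⟩, sem_congr ⟨q, by linear_combination hq'⟩ ht⟩
  · rintro ⟨_, ⟨t, rfl⟩, ht⟩
    exact ⟨t, sem_congr ⟨-q, by linear_combination -hq'⟩ ht⟩

theorem sem_addV (A c r : ℕ) (α : ℤ_[2]) :
    α ∈ sem (addV A c r) ↔ ∃ v ∈ bV c r, α - v ∈ sem A := by
  unfold addV
  rw [sem_lor, sem_lor, sem_lor]
  have h1 := sem_coset_mod A c r 1 α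
  have h2 := sem_coset_mod A c r 2 α
  norm_num at h1 h2
  have h1' : α ∈ sem (coset A (Nat.mod (Nat.mul 4 c) 64) (Nat.add r 2)) ↔ _ := h1
  have h2' : α ∈ sem (coset A (Nat.mod (Nat.mul 16 c) 64) (Nat.add r 4)) ↔ _ := h2
  rw [h1', h2', sem_coset]
  constructor
  · rintro (h | ⟨t, h⟩ | ⟨p, hp, h⟩ | ⟨p, hp, h⟩)
    · exact ⟨0, Or.inl rfl, by simpa using h⟩
    · exact ⟨_, Or.inr ⟨0, _, ⟨t, rfl⟩, rfl⟩, by simpa using h⟩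
    · exact ⟨_, Or.inr ⟨1, _, hp, rfl⟩, by simpa using h⟩
    · exact ⟨_, Or.inr ⟨2, _, hp, rfl⟩, by norm_num; exact h⟩
  · rintro ⟨v, rfl | ⟨j, p, hp, rfl⟩, h⟩
    · left; simpa using h
    · match j with
      | 0 => obtain ⟨t, rfl⟩ := hp; right; left; exact ⟨t, by simpa using h⟩
      | 1 => right; right; left; exact ⟨p, hp, by simpa using h⟩
      | 2 => right; right; right; exact ⟨p, hp, by norm_num at h; exact h⟩
      | j + 3 => left; exact sem_congr ⟨-(4 ^ j * p), by rw [pow_add]; ring⟩ h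

/-- The masks describe the sets of values and primitive values. -/
structure Good (V P : Set ℤ_[2]) (Vm Pm : ℕ) : Prop where
  up : ∀ α ∈ V, α ∈ sem Vm
  lo : ∀ α ∈ sem Vm, ∃ v ∈ V, (64 : ℤ_[2]) ∣ α - v
  pr : ∀ α ∈ sem Pm, α ∈ P
  zero : (0 : ℤ_[2]) ∈ V
  four : ∀ α ∈ V, 4 * α ∈ V
  sub : P ⊆ V

def addVs (V : Set ℤ_[2]) (c r : ℕ) : Set ℤ_[2] := {α | ∃ b ∈ bV c r, ∃ v ∈ V, α = b + v}
def addPs (V P : Set ℤ_[2]) (c r : ℕ) : Set ℤ_[2] :=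
  {α | (∃ b ∈ bP c r, ∃ v ∈ V, α = b + v) ∨ (∃ b ∈ bV c r, ∃ v ∈ P, α = b + v)}

theorem bP_sub (c r : ℕ) : bP c r ⊆ bV c r := fun p hp => Or.inr ⟨0, p, hp, by simp⟩

theorem Good.add {V P : Set ℤ_[2]} {Vm Pm : ℕ} (g : Good V P Vm Pm) (c r : ℕ) (hr : r ≤ 6) :
    Good (addVs V c r) (addPs V P c r) (addV Vm c r) (addP Vm Pm c r) where
  up := by
    rintro _ ⟨b, hb, v, hv, rfl⟩
    rw [sem_addV]
    exact ⟨b, hb, by simpa using g.up v hv⟩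
  lo := by
    intro α h
    rw [sem_addV] at h
    obtain ⟨b, hb, h⟩ := h
    obtain ⟨v, hv, h⟩ := g.lo _ h
    exact ⟨b + v, ⟨b, hb, v, hv, rfl⟩, by convert h using 1; ring⟩
  pr := by
    intro α h
    unfold addP at h
    rw [sem_lor, sem_coset, sem_addV] at h
    rcases h with ⟨t, h⟩ | ⟨b, hb, h⟩
    · obtain ⟨v, hv, s, hs⟩ := g.lo _ h
      left
      refine ⟨α - v, ⟨t + 2 ^ (6 - r) * s, ?_⟩, v, hv, by ring⟩
      have : (2 : ℤ_[2]) ^ r * 2 ^ (6 - r) = 64 := by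
        rw [← pow_add, Nat.add_sub_cancel' hr]; norm_num
      linear_combination hs - s * this
    · right
      exact ⟨b, hb, α - b, g.pr _ h, by ring⟩
  zero := ⟨0, Or.inl rfl, 0, g.zero, by simp⟩
  four := by
    rintro _ ⟨b, hb, v, hv, rfl⟩
    refine ⟨4 * b, ?_, 4 * v, g.four v hv, by ring⟩
    rcases hb with rfl | ⟨j, p, hp, rfl⟩
    · left; simp
    · right; exact ⟨j + 1, p, hp, by ring⟩
  sub := by
    rintro _ (⟨b, hb, v, hv, rfl⟩ | ⟨b, hb, v, hv, rfl⟩)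
    · exact ⟨b, bP_sub _ _ hb, v, hv, rfl⟩
    · exact ⟨b, hb, v, g.sub hv, rfl⟩

theorem exists_res (α : ℤ_[2]) : ∃ i < 64, (64 : ℤ_[2]) ∣ α - ((i : ℕ) : ℤ_[2]) := by
  refine ⟨α.appr 6, PadicInt.appr_lt α 6, ?_⟩
  have h := PadicInt.appr_spec 6 α
  rw [Ideal.mem_span_singleton] at h
  convert h using 1; norm_num

theorem mem_full (α : ℤ_[2]) : α ∈ sem full := by
  obtain ⟨i, hi, h⟩ := exists_res α
  refine ⟨i, ?_, h⟩
  have : full = 2 ^ 64 - 1 := by norm_num [full]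
  rw [this, Nat.testBit_two_pow_sub_one]
  simpa using hi

theorem not_full {A : ℕ} (h : A < full) : ∃ α, α ∉ sem A := by
  have hf : full = 2 ^ 64 - 1 := by norm_num [full]
  have : ∃ i < 64, A.testBit i = false := by
    by_contra! hc
    apply h.ne
    rw [hf]
    apply Nat.eq_of_testBit_eq
    intro i
    rw [Nat.testBit_two_pow_sub_one]
    by_cases hi : i < 64
    · simpa [hi] using hc i hi
    · have : A.testBit i = false := Nat.testBit_lt_two_pow
        (lt_of_lt_of_le (by omega : A < 2 ^ 64) (Nat.pow_le_pow_right (by norm_num) (by omega)))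
      simp [hi, this]
  obtain ⟨i, hi, hi'⟩ := this
  refine ⟨i, ?_⟩
  rintro ⟨j, hj, hd⟩
  have hj64 : j < 64 := by
    by_contra hc
    have : A.testBit j = false := Nat.testBit_lt_two_pow
        (lt_of_lt_of_le (by omega : A < 2 ^ 64) (Nat.pow_le_pow_right (by norm_num) (by omega)))
    simp [this] at hj
  have h2 : ((2 ^ 6 : ℕ) : ℤ) ∣ (i : ℤ) - j := by
    have := (PadicInt.norm_int_le_pow_iff_dvd (p := 2) (k := (i : ℤ) - j) (n := 6))
    have h3 := (PadicInt.norm_le_pow_iff_mem_span_pow (p := 2) (((i : ℤ) - j : ℤ) : ℤ_[2]) 6)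
    have h4 := this.1 (h3.2 (by
      rw [Ideal.mem_span_singleton]
      push_cast; convert hd using 1; norm_num))
    exact_mod_cast h4
  have : i = j := by
    norm_num at h2; omega
  subst this
  rw [hi'] at hj
  exact absurd hj (by decide)

theorem mem_m4 {α : ℤ_[2]} (h : α ∈ sem m4) : (4 : ℤ_[2]) ∣ α := by
  obtain ⟨i, hi, t, ht⟩ := h
  have h64 : i < 64 := by
    by_contra hc
    have : m4.testBit i = false := Nat.testBit_lt_two_pow
        (lt_of_lt_of_le (by norm_num [m4] : m4 < 2 ^ 64)
          (Nat.pow_le_pow_right (by norm_num) (by omega)))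
    simp [this] at hi
  have key : ∀ i < 64, m4.testBit i = true → i % 4 = 0 := by decide
  have := key i h64 hi
  obtain ⟨j, rfl⟩ : ∃ j, i = 4 * j := ⟨i / 4, by omega⟩
  exact ⟨j + 16 * t, by push_cast at ht; linear_combination ht⟩

theorem unit_of_odd (s : ℤ_[2]) : IsUnit (2 * s + 1) := by
  rw [PadicInt.isUnit_iff]
  by_contra h
  have h1 : ‖2 * s + 1‖ < 1 := lt_of_le_of_ne (PadicInt.norm_le_one _) h
  have h2 : ‖(2 * s : ℤ_[2])‖ < 1 := by
    have : ‖(2 : ℤ_[2])‖ < 1 := by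
      have := PadicInt.norm_p (p := 2)
      push_cast at this
      rw [this]; norm_num
    rw [norm_mul]
    calc _ ≤ ‖(2 : ℤ_[2])‖ * 1 := by gcongr; exact PadicInt.norm_le_one _
      _ < 1 := by simpa using this
  have h3 : ‖(1 : ℤ_[2])‖ < 1 := by
    have : (1 : ℤ_[2]) = (2 * s + 1) + -(2 * s) := by ring
    rw [this]
    refine lt_of_le_of_lt (PadicInt.nonarchimedean _ _) (max_lt h1 (by simpa using h2))
  simp at h3

theorem not_unit_two (s : ℤ_[2]) : ¬ IsUnit (2 * s) := by
  intro h
  have h2 := isUnit_of_mul_isUnit_left h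
  have := PadicInt.norm_p (p := 2)
  rw [PadicInt.isUnit_iff] at h2
  push_cast at this
  rw [this] at h2
  norm_num at h2

theorem two_ne : (2 : ℤ_[2]) ≠ 0 := by norm_num

theorem eq_pow_mul {α : ℤ_[2]} (h : α ≠ 0) : ∃ (k : ℕ) (u : ℤ_[2]), IsUnit u ∧ α = 2 ^ k * u := by
  refine ⟨α.valuation, PadicInt.unitCoeff h, Units.isUnit _, ?_⟩
  have := PadicInt.unitCoeff_spec h
  rw [mul_comm]; exact_mod_cast this

theorem univ_of {V P : Set ℤ_[2]} {Vm Pm : ℕ} (g : Good V P Vm Pm)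
    (h : Nat.lor Pm m4 = full) (α : ℤ_[2]) : α ∈ V := by
  by_cases h0 : α = 0
  · rw [h0]; exact g.zero
  obtain ⟨k, u, hu, rfl⟩ := eq_pow_mul h0
  clear h0
  induction k using Nat.strong_induction_on with
  | _ k ih =>
    have hm : (2 ^ k * u : ℤ_[2]) ∈ sem (Nat.lor Pm m4) := by rw [h]; exact mem_full _
    rw [sem_lor] at hm
    rcases hm with hm | hm
    · exact g.sub (g.pr _ hm)
    · obtain ⟨t, ht⟩ := mem_m4 hm
      match k with
      | 0 => exact absurd hu (by
          rw [show u = 2 * (2 * t) by linear_combination ht]; exact not_unit_two _)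
      | 1 => exact absurd hu (by
          rw [show u = 2 * t by
            apply mul_left_cancel₀ two_ne; linear_combination ht]; exact not_unit_two _)
      | k + 2 =>
        have := g.four _ (ih k (by omega))
        convert this using 1; ring

theorem quad_root (a b c : ℤ_[2]) (hb : IsUnit b) : ∃ x : ℤ_[2], a * x ^ 2 + b * x + 2 * c = 0 := by
  let F : Polynomial ℤ_[2] := Polynomial.C a * Polynomial.X ^ 2 + Polynomial.C b * Polynomial.X
    + Polynomial.C (2 * c)
  have hn : ‖F.aeval (0 : ℤ_[2])‖ < ‖F.derivative.aeval (0 : ℤ_[2])‖ ^ 2 := by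
    have h1 : F.aeval (0 : ℤ_[2]) = 2 * c := by simp [F]
    have h2 : F.derivative.aeval (0 : ℤ_[2]) = b := by
      simp [F]
    rw [h1, h2, PadicInt.isUnit_iff.mp hb]
    have : ‖2 * c‖ ≠ 1 := fun h => not_unit_two c (PadicInt.isUnit_iff.mpr h)
    simpa using lt_of_le_of_ne (PadicInt.norm_le_one _) this
  obtain ⟨z, hz, _⟩ := hensels_lemma hn
  exact ⟨z, by simpa [F] using hz⟩

section modules
variable {R : Type} [AddCommGroup R] [Module ℤ_[2] R]

/-- Not divisible by two. -/
def Prim {R : Type} [AddCommGroup R] [Module ℤ_[2] R] (y : R) : Prop :=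
  ∀ z : R, y ≠ (2 : ℤ_[2]) • z

/-- The claim to be proved at each node. -/
def Cl (Q : QuadraticForm ℤ_[2] R) (V P : Set ℤ_[2]) : Prop :=
  (∀ α, ∃ q ∈ V, ∃ y, α = q + Q y) →
    ∀ α, (∃ q ∈ P, ∃ y, α = q + Q y) ∨ (∃ q ∈ V, ∃ y, Prim y ∧ α = q + Q y)

theorem split (Q : QuadraticForm ℤ_[2] R) (V P : Set ℤ_[2]) (G R' : Submodule ℤ_[2] R)
    (hdec : ∀ y, ∃ g ∈ G, ∃ y' ∈ R', y = g + y')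
    (horth : ∀ g ∈ G, ∀ y' ∈ R', Q (g + y') = Q g + Q y')
    (hdis : ∀ g ∈ G, g ∈ R' → g = 0) (c r : ℕ)
    (hG1 : ∀ g ∈ G, Q g ∈ bV c r) (hG2 : ∀ p ∈ bP c r, ∃ g ∈ G, Prim g ∧ Q g = p)
    (h : Cl (Q.comp R'.subtype) (addVs V c r) (addPs V P c r)) : Cl Q V P := by
  intro hu α
  have hdiv : ∀ g ∈ G, ∀ y ∈ R', ∀ z, g + y = (2 : ℤ_[2]) • z →
      ∃ g1 ∈ G, ∃ y1 ∈ R', g = (2 : ℤ_[2]) • g1 ∧ y = (2 : ℤ_[2]) • y1 := by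
    intro g hg y hy z hz
    obtain ⟨g1, hg1, y1, hy1, rfl⟩ := hdec z
    have e1 : g - (2 : ℤ_[2]) • g1 = (2 : ℤ_[2]) • y1 - y := by
      rw [smul_add] at hz
      rw [sub_eq_sub_iff_add_eq_add, hz, add_comm]
    have e2 : g - (2 : ℤ_[2]) • g1 = 0 := by
      apply hdis _ (G.sub_mem hg (G.smul_mem _ hg1))
      rw [e1]
      exact R'.sub_mem (R'.smul_mem _ hy1) hy
    refine ⟨g1, hg1, y1, hy1, sub_eq_zero.mp e2, ?_⟩
    rw [e2] at e1
    exact (sub_eq_zero.mp e1.symm).symm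
  have hGV : ∀ v ∈ bV c r, ∃ g ∈ G, Q g = v := by
    rintro v (rfl | ⟨j, p, hp, rfl⟩)
    · exact ⟨0, G.zero_mem, by simp⟩
    · obtain ⟨g, hg, _, rfl⟩ := hG2 p hp
      refine ⟨(2 : ℤ_[2]) ^ j • g, G.smul_mem _ hg, ?_⟩
      rw [QuadraticMap.map_smul, smul_eq_mul, ← mul_pow]; norm_num
  have hu' : ∀ α, ∃ q ∈ addVs V c r, ∃ y, α = q + (Q.comp R'.subtype) y := by
    intro α
    obtain ⟨q, hq, y, rfl⟩ := hu α
    obtain ⟨g, hg, y', hy', rfl⟩ := hdec y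
    refine ⟨Q g + q, ⟨_, hG1 g hg, q, hq, rfl⟩, ⟨y', hy'⟩, ?_⟩
    rw [horth g hg y' hy']
    simp; ring
  rcases h hu' α with ⟨q, hq, ⟨y, hy⟩, h⟩ | ⟨q, hq, ⟨y, hy⟩, hp, h⟩
  · simp only [QuadraticMap.comp_apply, Submodule.subtype_apply] at h
    rcases hq with ⟨b, hb, v, hv, rfl⟩ | ⟨b, hb, v, hv, rfl⟩
    · obtain ⟨g, hg, hgp, rfl⟩ := hG2 b hb
      right
      refine ⟨v, hv, g + y, ?_, ?_⟩
      · intro z hz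
        obtain ⟨g1, _, _, _, h1, _⟩ := hdiv g hg y hy z hz
        exact hgp _ h1
      · rw [horth g hg y hy, h]; ring
    · obtain ⟨g, hg, rfl⟩ := hGV b hb
      left
      exact ⟨v, hv, g + y, by rw [horth g hg y hy, h]; ring⟩
  · simp only [QuadraticMap.comp_apply, Submodule.subtype_apply] at h
    obtain ⟨b, hb, v, hv, rfl⟩ := hq
    obtain ⟨g, hg, rfl⟩ := hGV b hb
    right
    refine ⟨v, hv, g + y, ?_, by rw [horth g hg y hy, h]; ring⟩
    intro z hz
    obtain ⟨_, _, y1, hy1, _, h2⟩ := hdiv g hg y hy z hz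
    exact hp ⟨y1, hy1⟩ (Subtype.ext h2)

theorem even_sq_add (x : ℤ_[2]) : ∃ y, x ^ 2 + x = 2 * y := by
  rcases parity x with ⟨s, rfl⟩ | ⟨s, rfl⟩
  · exact ⟨2 * s ^ 2 + s, by ring⟩
  · exact ⟨2 * s ^ 2 + 3 * s + 1, by ring⟩

theorem odd_of_unit {w : ℤ_[2]} (h : IsUnit w) : ∃ x, w = 2 * x + 1 := by
  rcases parity w with ⟨s, rfl⟩ | h'
  · exact absurd h (not_unit_two s)
  · exact h'

theorem split_diag (Q : QuadraticForm ℤ_[2] R) (V P : Set ℤ_[2]) (m u0 : ℕ) (u t : ℤ_[2])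
    (hu : IsUnit u) (h8 : u = u0 + 8 * t) (e : R) (he : Q e = 2 ^ m * u)
    (hB : ∀ y, ∃ s, QuadraticMap.polar Q e y = 2 ^ (m + 1) * s)
    (h : Cl (Q.comp (LinearMap.ker (Q.polarBilin e)).subtype) (addVs V (2 ^ m * u0) (m + 3))
      (addPs V P (2 ^ m * u0) (m + 3))) : Cl Q V P := by
  have hee : QuadraticMap.polar Q e e = 2 ^ (m + 1) * u := by
    rw [QuadraticMap.polar_self, he]; simp; ring
  have h2m : (2 : ℤ_[2]) ^ (m + 1) ≠ 0 := pow_ne_zero _ two_ne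
  obtain ⟨ui, hui⟩ := hu.exists_right_inv
  refine split Q V P (Submodule.span ℤ_[2] {e}) _ ?_ ?_ ?_ _ _ ?_ ?_ h
  · intro y
    obtain ⟨s, hs⟩ := hB y
    refine ⟨(s * ui) • e, Submodule.smul_mem _ _ (Submodule.mem_span_singleton_self e),
      y - (s * ui) • e, ?_, by abel⟩
    rw [LinearMap.mem_ker, map_sub, map_smul]
    simp only [QuadraticMap.polarBilin_apply_apply, hee, hs, smul_eq_mul]
    linear_combination -(2 ^ (m + 1) * s) * hui
  · intro g hg y hy
    obtain ⟨s, rfl⟩ := Submodule.mem_span_singleton.mp hg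
    have hy' : QuadraticMap.polar Q e y = 0 := hy
    rw [QuadraticMap.map_add Q, QuadraticMap.polar_smul_left, hy']; simp
  · intro g hg hg'
    obtain ⟨s, rfl⟩ := Submodule.mem_span_singleton.mp hg
    have hy' : QuadraticMap.polar Q e (s • e) = 0 := hg'
    rw [QuadraticMap.polar_smul_right, hee, smul_eq_mul] at hy'
    have : s = 0 := by
      rcases mul_eq_zero.mp hy' with h | h
      · exact h
      · exact absurd h (mul_ne_zero h2m hu.ne_zero)
    simp [this]
  · intro g hg
    obtain ⟨s, rfl⟩ := Submodule.mem_span_singleton.mp hg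
    by_cases hs : s = 0
    · left; simp [hs]
    · right
      obtain ⟨k, w, hw, rfl⟩ := eq_pow_mul hs
      obtain ⟨x, rfl⟩ := odd_of_unit hw
      obtain ⟨y, hy⟩ := even_sq_add x
      refine ⟨k, 2 ^ m * u * (2 * x + 1) ^ 2, ⟨t + u * y, ?_⟩, ?_⟩
      · push_cast
        rw [pow_add]
        linear_combination (2 ^ m : ℤ_[2]) * h8 + 4 * 2 ^ m * u * hy
      · rw [QuadraticMap.map_smul, he, smul_eq_mul,
          show (4 : ℤ_[2]) ^ k = 2 ^ k * 2 ^ k by rw [← mul_pow]; norm_num]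
        ring
  · rintro p ⟨q, rfl⟩
    -- need `u s² = u0 + 8 q`
    obtain ⟨x, hx⟩ := quad_root 1 1 (-((q - t) * ui)) isUnit_one
    refine ⟨(2 * x + 1) • e, Submodule.smul_mem _ _ (Submodule.mem_span_singleton_self e), ?_, ?_⟩
    · intro z hz
      obtain ⟨s, hs⟩ := hB z
      have h1 := congrArg (fun y => QuadraticMap.polar Q e y) hz
      simp only [QuadraticMap.polar_smul_right, hee, hs, smul_eq_mul] at h1
      have h2 : (2 * x + 1) * u = 2 * s := mul_left_cancel₀ h2m (by linear_combination h1)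
      exact not_unit_two s (h2 ▸ (unit_of_odd x).mul hu)
    · rw [QuadraticMap.map_smul, he, smul_eq_mul]
      push_cast
      rw [pow_add]
      linear_combination (4 * 2 ^ m * u : ℤ_[2]) * hx + 2 ^ m * h8 + 8 * 2 ^ m * (q - t) * hui

theorem common_pow (x z : ℤ_[2]) (h : ¬ (x = 0 ∧ z = 0)) : ∃ (k : ℕ) (x' z' : ℤ_[2]),
    x = 2 ^ k * x' ∧ z = 2 ^ k * z' ∧ (IsUnit x' ∨ IsUnit z') := by
  by_cases hx : x = 0
  · have hz : z ≠ 0 := fun hz => h ⟨hx, hz⟩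
    obtain ⟨k, u, hu, rfl⟩ := eq_pow_mul hz
    exact ⟨k, 0, u, by simp [hx], rfl, Or.inr hu⟩
  · obtain ⟨k, u, hu, rfl⟩ := eq_pow_mul hx
    by_cases hz : z = 0
    · exact ⟨k, u, 0, rfl, by simp [hz], Or.inl hu⟩
    · obtain ⟨l, v, hv, rfl⟩ := eq_pow_mul hz
      rcases le_total k l with hkl | hkl
      · obtain ⟨d, rfl⟩ := Nat.exists_eq_add_of_le hkl
        exact ⟨k, u, 2 ^ d * v, rfl, by ring, Or.inl hu⟩
      · obtain ⟨d, rfl⟩ := Nat.exists_eq_add_of_le hkl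
        exact ⟨l, 2 ^ d * u, v, by ring, rfl, Or.inr hv⟩

/-- The orthogonal complement of two vectors. -/
noncomputable def comp2 (Q : QuadraticForm ℤ_[2] R) (e f : R) : Submodule ℤ_[2] R :=
  LinearMap.ker ((Q.polarBilin e).prod (Q.polarBilin f))

theorem mem_comp2 (Q : QuadraticForm ℤ_[2] R) (e f y : R) :
    y ∈ comp2 Q e f ↔ QuadraticMap.polar Q e y = 0 ∧ QuadraticMap.polar Q f y = 0 := by
  simp [comp2]

theorem split_bin (Q : QuadraticForm ℤ_[2] R) (V P : Set ℤ_[2]) (m : ℕ) (a b c : ℤ_[2])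
    (hb : IsUnit b) (e f : R) (he : Q e = 2 ^ m * a) (hf : Q f = 2 ^ m * c)
    (hef : QuadraticMap.polar Q e f = 2 ^ m * b)
    (hB : ∀ x y, ∃ s, QuadraticMap.polar Q x y = 2 ^ m * s) (c0 r : ℕ)
    (h1 : ∀ x z, IsUnit x ∨ IsUnit z → 2 ^ m * (a * x ^ 2 + b * x * z + c * z ^ 2) ∈ bP c0 r)
    (h2 : ∀ p ∈ bP c0 r, ∃ x z, (IsUnit x ∨ IsUnit z) ∧
      2 ^ m * (a * x ^ 2 + b * x * z + c * z ^ 2) = p)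
    (h : Cl (Q.comp (comp2 Q e f).subtype) (addVs V c0 r) (addPs V P c0 r)) : Cl Q V P := by
  have hee : QuadraticMap.polar Q e e = 2 ^ m * (2 * a) := by
    rw [QuadraticMap.polar_self, he]; simp; ring
  have hff : QuadraticMap.polar Q f f = 2 ^ m * (2 * c) := by
    rw [QuadraticMap.polar_self, hf]; simp; ring
  have hfe : QuadraticMap.polar Q f e = 2 ^ m * b := by rw [QuadraticMap.polar_comm, hef]
  have h2m : (2 : ℤ_[2]) ^ m ≠ 0 := pow_ne_zero _ two_ne
  have hD : IsUnit (4 * a * c - b ^ 2) := by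
    obtain ⟨s, rfl⟩ := odd_of_unit hb
    have := unit_of_odd (2 * a * c - 2 * s ^ 2 - 2 * s - 1)
    convert this using 1; ring
  obtain ⟨D, hD'⟩ := hD.exists_right_inv
  have hQ : ∀ x z : ℤ_[2], Q (x • e + z • f) = 2 ^ m * (a * x ^ 2 + b * x * z + c * z ^ 2) := by
    intro x z
    rw [QuadraticMap.map_add Q, QuadraticMap.polar_smul_left, QuadraticMap.polar_smul_right,
      QuadraticMap.map_smul, QuadraticMap.map_smul, he, hf, hef]
    simp only [smul_eq_mul]; ring
  have hpe : ∀ x z : ℤ_[2], QuadraticMap.polar Q e (x • e + z • f) = 2 ^ m * (2 * a * x + b * z) := by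
    intro x z
    rw [QuadraticMap.polar_add_right, QuadraticMap.polar_smul_right, QuadraticMap.polar_smul_right,
      hee, hef]
    simp only [smul_eq_mul]; ring
  have hpf : ∀ x z : ℤ_[2], QuadraticMap.polar Q f (x • e + z • f) = 2 ^ m * (b * x + 2 * c * z) := by
    intro x z
    rw [QuadraticMap.polar_add_right, QuadraticMap.polar_smul_right, QuadraticMap.polar_smul_right,
      hff, hfe]
    simp only [smul_eq_mul]; ring
  have hmem : ∀ x z : ℤ_[2], x • e + z • f ∈ Submodule.span ℤ_[2] {e, f} := fun x z =>
    Submodule.mem_span_pair.mpr ⟨x, z, rfl⟩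
  refine split Q V P (Submodule.span ℤ_[2] {e, f}) _ ?_ ?_ ?_ _ _ ?_ ?_ h
  · intro y
    obtain ⟨p, hp⟩ := hB e y
    obtain ⟨q, hq⟩ := hB f y
    refine ⟨((2 * c * p - b * q) * D) • e + ((2 * a * q - b * p) * D) • f, hmem _ _,
      y - (((2 * c * p - b * q) * D) • e + ((2 * a * q - b * p) * D) • f), ?_, by abel⟩
    rw [mem_comp2, QuadraticMap.polar_sub_right, QuadraticMap.polar_sub_right, hpe, hpf, hp, hq]
    constructor
    · linear_combination -(2 ^ m * p) * hD'
    · linear_combination -(2 ^ m * q) * hD'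
  · intro g hg y hy
    obtain ⟨x, z, rfl⟩ := Submodule.mem_span_pair.mp hg
    rw [mem_comp2] at hy
    rw [QuadraticMap.map_add Q, QuadraticMap.polar_add_left, QuadraticMap.polar_smul_left,
      QuadraticMap.polar_smul_left, hy.1, hy.2]
    simp
  · intro g hg hy
    obtain ⟨x, z, rfl⟩ := Submodule.mem_span_pair.mp hg
    rw [mem_comp2, hpe, hpf] at hy
    have e1 := (mul_eq_zero.mp hy.1).resolve_left h2m
    have e2 := (mul_eq_zero.mp hy.2).resolve_left h2m
    have ex : x = 0 := by linear_combination 2 * c * D * e1 - b * D * e2 - x * hD'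
    have ez : z = 0 := by linear_combination 2 * a * D * e2 - b * D * e1 - z * hD'
    simp [ex, ez]
  · intro g hg
    obtain ⟨x, z, rfl⟩ := Submodule.mem_span_pair.mp hg
    by_cases hxz : x = 0 ∧ z = 0
    · left; simp [hxz.1, hxz.2]
    · right
      obtain ⟨k, x', z', rfl, rfl, hu⟩ := common_pow x z hxz
      refine ⟨k, _, h1 x' z' hu, ?_⟩
      rw [hQ, show (4 : ℤ_[2]) ^ k = 2 ^ k * 2 ^ k by rw [← mul_pow]; norm_num]
      ring
  · intro p hp
    obtain ⟨x, z, hu, rfl⟩ := h2 p hp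
    refine ⟨x • e + z • f, hmem _ _, ?_, hQ x z⟩
    intro w hw
    obtain ⟨p, hp⟩ := hB e w
    obtain ⟨q, hq⟩ := hB f w
    have w1 := congrArg (fun y => QuadraticMap.polar Q e y) hw
    have w2 := congrArg (fun y => QuadraticMap.polar Q f y) hw
    simp only [QuadraticMap.polar_smul_right, hp, hq, hpe, hpf, smul_eq_mul] at w1 w2
    have e1 : 2 * a * x + b * z = 2 * p := mul_left_cancel₀ h2m (by linear_combination w1)
    have e2 : b * x + 2 * c * z = 2 * q := mul_left_cancel₀ h2m (by linear_combination w2)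
    rcases hu with hu | hu
    · refine not_unit_two (q - c * z) ?_
      rw [show 2 * (q - c * z) = b * x by linear_combination -e2]
      exact hb.mul hu
    · refine not_unit_two (p - a * x) ?_
      rw [show 2 * (p - a * x) = b * z by linear_combination -e1]
      exact hb.mul hu

/-- A binary block splits off either as a hyperbolic or an anisotropic plane. -/
theorem split_block (Q : QuadraticForm ℤ_[2] R) (V P : Set ℤ_[2]) (m : ℕ) (b : ℤ_[2])
    (hb : IsUnit b) (e f : R) (hQ : ∀ x, ∃ s, Q x = 2 ^ m * s)
    (hef : QuadraticMap.polar Q e f = 2 ^ m * b)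
    (hB : ∀ x y, ∃ s, QuadraticMap.polar Q x y = 2 ^ m * s)
    (hH : ∀ e f, Cl (Q.comp (comp2 Q e f).subtype) (addVs V 0 m) (addPs V P 0 m))
    (hN : ∀ e f, Cl (Q.comp (comp2 Q e f).subtype) (addVs V (2 ^ m) (m + 1))
      (addPs V P (2 ^ m) (m + 1))) : Cl Q V P := by
  obtain ⟨a, ha⟩ := hQ e
  obtain ⟨c, hc⟩ := hQ f
  -- solving with second coordinate one
  have key : ∀ a c p : ℤ_[2], (∃ x0 s, a * x0 ^ 2 + b * x0 + c - p = 2 * s) →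
      ∃ x, a * x ^ 2 + b * x + c = p := by
    rintro a c p ⟨x0, s, hs⟩
    have hu : IsUnit (b + 2 * a * x0) := by
      obtain ⟨w, rfl⟩ := odd_of_unit hb
      convert unit_of_odd (w + a * x0) using 1; ring
    obtain ⟨x, hx⟩ := quad_root a _ s hu
    exact ⟨x0 + x, by linear_combination hx + hs⟩
  have ev : ∀ a c p : ℤ_[2], (∃ a', a = 2 * a') → ∃ x, a * x ^ 2 + b * x + c = p := by
    rintro _ c p ⟨a', rfl⟩
    apply key
    rcases parity (c - p) with ⟨s, hs⟩ | ⟨s, hs⟩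
    · exact ⟨0, s, by linear_combination hs⟩
    · obtain ⟨w, rfl⟩ := odd_of_unit hb
      exact ⟨1, a' + w + 1 + s, by linear_combination hs⟩
  have hmem0 : ∀ t : ℤ_[2], 2 ^ m * t ∈ bP 0 m := fun t => ⟨t, by simp⟩
  rcases parity a with ⟨a', ha'⟩ | ⟨a', ha'⟩
  · refine split_bin Q V P m a b c hb e f ha hc hef hB 0 m (fun x z _ => hmem0 _) ?_ (hH e f)
    rintro _ ⟨p, rfl⟩
    obtain ⟨x, hx⟩ := ev a c p ⟨a', ha'⟩
    exact ⟨x, 1, Or.inr isUnit_one, by push_cast; linear_combination 2 ^ m * hx⟩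
  rcases parity c with ⟨c', hc'⟩ | ⟨c', hc'⟩
  · refine split_bin Q V P m a b c hb e f ha hc hef hB 0 m (fun x z _ => hmem0 _) ?_ (hH e f)
    rintro _ ⟨p, rfl⟩
    obtain ⟨x, hx⟩ := ev c a p ⟨c', hc'⟩
    exact ⟨1, x, Or.inl isUnit_one, by push_cast; linear_combination 2 ^ m * hx⟩
  · refine split_bin Q V P m a b c hb e f ha hc hef hB (2 ^ m) (m + 1) ?_ ?_ (hN e f)
    · intro x z hxz
      have : ∃ t, a * x ^ 2 + b * x * z + c * z ^ 2 = 2 * t + 1 := by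
        obtain ⟨w, rfl⟩ := odd_of_unit hb
        subst ha' hc'
        rcases parity x with ⟨x, rfl⟩ | ⟨x, rfl⟩ <;> rcases parity z with ⟨z, rfl⟩ | ⟨z, rfl⟩
        · rcases hxz with h | h
          · exact absurd h (not_unit_two _)
          · exact absurd h (not_unit_two _)
        · exact ⟨(2 * a' + 1) * 2 * x ^ 2 + (2 * w + 1) * x * (2 * z + 1) +
            c' * (2 * z + 1) ^ 2 + 2 * z ^ 2 + 2 * z, by ring⟩
        · exact ⟨(2 * c' + 1) * 2 * z ^ 2 + (2 * w + 1) * z * (2 * x + 1) +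
            a' * (2 * x + 1) ^ 2 + 2 * x ^ 2 + 2 * x, by ring⟩
        · exact ⟨a' * (2 * x + 1) ^ 2 + 2 * x ^ 2 + 2 * x + c' * (2 * z + 1) ^ 2 + 2 * z ^ 2 + 2 * z
            + w * (2 * x + 1) * (2 * z + 1) + 2 * x * z + x + z + 1, by ring⟩
      obtain ⟨t, ht⟩ := this
      exact ⟨t, by rw [ht]; push_cast; ring⟩
    · rintro _ ⟨p, rfl⟩
      obtain ⟨x, hx⟩ := key a c (1 + 2 * p) ⟨0, c' - p, by linear_combination hc'⟩
      exact ⟨x, 1, Or.inr isUnit_one, by push_cast; linear_combination 2 ^ m * hx⟩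

theorem finrank_ker_ge {W : Type} [AddCommGroup W] [Module ℤ_[2] W] [Module.Finite ℤ_[2] W]
    [Module.Finite ℤ_[2] R] (φ : R →ₗ[ℤ_[2]] W) :
    Module.finrank ℤ_[2] R ≤ Module.finrank ℤ_[2] W + Module.finrank ℤ_[2] (LinearMap.ker φ) := by
  rw [← Submodule.finrank_quotient_add_finrank (LinearMap.ker φ)]
  have := (φ.quotKerEquivRange).finrank_eq
  rw [this]
  gcongr
  exact Submodule.finrank_le _

theorem subsing [Module.Finite ℤ_[2] R] (hc : ∀ z : R, ¬ Prim z) : Subsingleton R := by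
  have hb : (⊤ : Submodule ℤ_[2] R) = ⊥ := by
    refine Submodule.eq_bot_of_le_smul_of_le_jacobson_bot (Ideal.span {(2 : ℤ_[2])}) ⊤
      Module.Finite.fg_top ?_ ?_
    · intro y _
      have := hc y
      unfold Prim at this
      push Not at this
      obtain ⟨z, rfl⟩ := this
      exact Submodule.smul_mem_smul (Ideal.mem_span_singleton_self _) trivial
    · rw [IsLocalRing.jacobson_eq_maximalIdeal _ bot_ne_top, Ideal.span_singleton_le_iff_mem,
        IsLocalRing.mem_maximalIdeal, mem_nonunits_iff]
      simpa using not_unit_two 1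
  exact (Submodule.subsingleton_iff ℤ_[2]).mp (subsingleton_of_bot_eq_top hb.symm)

theorem force_eq {α : Type} (n : ℕ) (f : ℕ → α) : force n f = f n := by
  cases n <;> rfl

end modules

theorem sound (k : ℕ) : ∀ (Vm Pm d m : ℕ) (ph : Bool), check k Vm Pm d m ph = true →
    ∀ (R : Type) [AddCommGroup R] [Module ℤ_[2] R] [Module.Finite ℤ_[2] R]
      (Q : QuadraticForm ℤ_[2] R) (V P : Set ℤ_[2]), Good V P Vm Pm →
      5 ≤ d + Module.finrank ℤ_[2] R →
      (∀ x, ∃ s, Q x = 2 ^ m * s) →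
      (∀ x y, ∃ s, QuadraticMap.polar Q x y = 2 ^ (m + if ph then 1 else 0) * s) → Cl Q V P := by
  induction k with
  | zero => intro Vm Pm d m ph h; simp [check] at h
  | succ k ih =>
    intro Vm Pm d m ph h R _ _ _ Q V P g hrk hQ hB
    rw [check.eq_def] at h
    dsimp only at h
    simp only [Bool.or_eq_true, Bool.and_eq_true, force_eq] at h
    rcases h with h | h | ⟨hd, h⟩ | ⟨hm, h⟩
    · -- contradiction
      intro hu
      obtain ⟨α, hα⟩ := not_full (Nat.le_of_ble_eq_true h)
      exfalso; apply hα
      rw [sem_grow _ _ _ (by change 6 ≤ m + (6 - m); omega)]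
      obtain ⟨q, hq, y, rfl⟩ := hu α
      obtain ⟨s, hs⟩ := hQ y
      exact ⟨s, by rw [hs]; simpa using g.up q hq⟩
    · -- primitively universal
      intro _ α
      have : Pm = full := Nat.eq_of_beq_eq_true h
      left
      exact ⟨α, g.pr _ (this ▸ mem_full α), 0, by simp⟩
    · -- universal, extra vector
      intro _ α
      have hd' : d ≤ 4 := Nat.le_of_ble_eq_true hd
      have hun := univ_of g (Nat.eq_of_beq_eq_true h)
      have hz : ∃ z : R, Prim z := by
        by_contra! hc
        have : Subsingleton R := subsing hc
        have := Module.finrank_zero_of_subsingleton (R := ℤ_[2]) (M := R)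
        omega
      obtain ⟨z, hz⟩ := hz
      right
      exact ⟨α - Q z, hun _, z, hz, by ring⟩
    · have hm' : m ≤ 3 := Nat.le_of_ble_eq_true hm
      cases ph with
      | false =>
        simp only [Bool.false_eq_true, if_false, Nat.add_zero, Bool.and_eq_true] at h hB
        obtain ⟨hH, hN, hE⟩ := h
        by_cases hex : ∃ e f b, IsUnit b ∧ QuadraticMap.polar Q e f = 2 ^ m * b
        · obtain ⟨e, f, b, hb, hef⟩ := hex
          have hfr : ∀ e f, Module.finrank ℤ_[2] R ≤ 2 + Module.finrank ℤ_[2] (comp2 Q e f) := by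
            intro e f
            have := finrank_ker_ge ((Q.polarBilin e).prod (Q.polarBilin f))
            have h2 : Module.finrank ℤ_[2] (ℤ_[2] × ℤ_[2]) = 2 := by simp
            rw [h2] at this
            exact this
          refine split_block Q V P m b hb e f hQ hef hB ?_ ?_
          · intro e f
            refine ih _ _ _ _ _ hH _ _ _ _ (g.add 0 m (by omega)) ?_ ?_ ?_
            · have := hfr e f
              change 5 ≤ d + 2 + _
              omega
            · intro x; exact hQ x
            · intro x y; exact hB x y
          · intro e f
            refine ih _ _ _ _ _ hN _ _ _ _ (g.add (2 ^ m) (m + 1) (by omega)) ?_ ?_ ?_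
            · have := hfr e f
              change 5 ≤ d + 2 + _
              omega
            · intro x; exact hQ x
            · intro x y; exact hB x y
        · refine ih _ _ _ _ _ hE _ _ _ _ g hrk hQ ?_
          intro x y
          obtain ⟨s, hs⟩ := hB x y
          rcases parity s with ⟨t, rfl⟩ | ⟨t, rfl⟩
          · exact ⟨t, by rw [hs]; simp only [if_true]; ring⟩
          · exact absurd ⟨x, y, _, unit_of_odd t, hs⟩ hex
      | true =>
        simp only [if_true, Bool.and_eq_true] at h hB
        obtain ⟨h1, h3, h5, h7, hE⟩ := h
        by_cases hex : ∃ e u, IsUnit u ∧ Q e = 2 ^ m * u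
        · obtain ⟨e, u, hu, he⟩ := hex
          have hfr : Module.finrank ℤ_[2] R ≤
              1 + Module.finrank ℤ_[2] (LinearMap.ker (Q.polarBilin e)) := by
            have := finrank_ker_ge (Q.polarBilin e)
            simpa using this
          have main : ∀ u0 : ℕ, (∃ t, u = u0 + 8 * t) →
              check k (addV Vm (2 ^ m * u0) (m + 3)) (addP Vm Pm (2 ^ m * u0) (m + 3)) (d + 1) m true
                = true → Cl Q V P := by
            rintro u0 ⟨t, ht⟩ hc
            refine split_diag Q V P m u0 u t hu ht e he (fun y => hB e y) ?_
            refine ih _ _ _ _ _ hc _ _ _ _ (g.add _ (m + 3) (by omega)) ?_ ?_ ?_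
            · omega
            · intro x; exact hQ x
            · intro x y; exact hB x y
          obtain ⟨x, hx⟩ := odd_of_unit hu
          rcases parity x with ⟨y, rfl⟩ | ⟨y, rfl⟩ <;> rcases parity y with ⟨z, rfl⟩ | ⟨z, rfl⟩
          · exact main 1 ⟨z, by rw [hx]; push_cast; ring⟩ (by rw [mul_one]; exact h1)
          · exact main 5 ⟨z, by rw [hx]; push_cast; ring⟩ h5
          · exact main 3 ⟨z, by rw [hx]; push_cast; ring⟩ h3
          · exact main 7 ⟨z, by rw [hx]; push_cast; ring⟩ h7
        · have hQ' : ∀ x, ∃ s, Q x = 2 ^ (m + 1) * s := by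
            intro x
            obtain ⟨s, hs⟩ := hQ x
            rcases parity s with ⟨t, rfl⟩ | ⟨t, rfl⟩
            · exact ⟨t, by rw [hs]; ring⟩
            · exact absurd ⟨x, _, unit_of_odd t, hs⟩ hex
          refine ih _ _ _ _ _ hE _ _ _ _ g hrk hQ' ?_
          intro x y
          exact hB x y

set_option maxRecDepth 100000 in
theorem check_true : check 20 1 0 0 0 false = true := by decide +kernel

end PU

/-- Proposition 5.12: a `ℤ_[2]`-universal quadratic form in `n ≥ 5` variables is
primitively `ℤ_[2]`-universal. -/
theorem stmt_19 {n : ℕ} (hn : 5 ≤ n) (a : Fin n → Fin n → ℤ_[2])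
    (Q : (Fin n → ℤ_[2]) → ℤ_[2])
    (hQ : ∀ x, Q x = ∑ i : Fin n, ∑ j ∈ Finset.Ici i, a i j * x i * x j)
    (huniv : ∀ α : ℤ_[2], ∃ x : Fin n → ℤ_[2], Q x = α) :
    ∀ α : ℤ_[2], α ≠ 0 →
      ∃ x : Fin n → ℤ_[2], (∃ i, IsUnit (x i)) ∧ Q x = α := by
  intro α _
  let F : QuadraticForm ℤ_[2] (Fin n → ℤ_[2]) := ∑ i : Fin n, ∑ j ∈ Finset.Ici i,
    a i j • QuadraticMap.linMulLin (LinearMap.proj i) (LinearMap.proj j)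
  have hF : ∀ x, F x = Q x := by
    intro x
    rw [hQ]
    simp [F, mul_assoc]
  have g : PU.Good {0} ∅ 1 0 := by
    refine ⟨?_, ?_, ?_, rfl, ?_, ?_⟩
    · rintro _ rfl
      exact ⟨0, by simp, by simp⟩
    · rintro α ⟨i, hi, h⟩
      have : i = 0 := by
        by_contra h0
        simp [Nat.testBit_one_eq_true_iff_self_eq_zero] at hi
        exact h0 hi
      subst this
      exact ⟨0, rfl, by simpa using h⟩
    · rintro α ⟨i, hi, h⟩
      simp at hi
    · rintro _ rfl
      simp
    · exact Set.empty_subset _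
  have := PU.sound 20 1 0 0 0 false PU.check_true (Fin n → ℤ_[2]) F {0} ∅ g
    (by simpa using hn) (fun x => ⟨F x, by simp⟩)
    (fun x y => ⟨QuadraticMap.polar F x y, by simp⟩)
    (fun α => by
      obtain ⟨x, hx⟩ := huniv α
      exact ⟨0, rfl, x, by rw [hF, hx, zero_add]⟩) α
  rcases this with ⟨q, hq, _⟩ | ⟨q, hq, y, hy, h⟩
  · exact absurd hq (Set.notMem_empty q)
  · have hq' : q = 0 := hq
    refine ⟨y, ?_, by rw [h, hq', hF, zero_add]⟩
    by_contra! hc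
    have : ∀ i, ∃ s, y i = 2 * s := by
      intro i
      rcases PU.parity (y i) with h | ⟨s, hs⟩
      · exact h
      · exact absurd (hs ▸ PU.unit_of_odd s) (hc i)
    choose z hz using this
    exact hy z (funext fun i => by simp [hz i])
end
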